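/- arXiv:2504.06865 — 6 statements merged into one kernel-verified Lean document; each statement's English description precedes it below -/
import Mathlib

section
/- Let k ≤ n be positive integers and let c, ε > 0. Then for every η > 0 there exist constants c₁ ∈ (0, η) and ε' ∈ (0, η) (depending only on n, ε and η) with the following property: for every real n×k matrix A = (a_{j,i}) satisfying ‖AᵀA − I_k‖ ≤ c₁ and ‖A‖² ≤ c (Frobenius norms), and for all real numbers λ₁ ≤ λ₂ ≤ … ≤ λₙ with λ₁ ≥ −ε' and λ_k ≥ ε/(2k), one has max(0, Σ_{i=1}^{k} Σ_{j=1}^{n} λ_j a_{j,i}²) ≥ √ε' · (λ₁ + ⋯ + λ_k). -/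
open Matrix

/-- The Frobenius (entrywise ℓ²) norm of a real matrix. -/
noncomputable def frobNorm {m n : ℕ} (A : Matrix (Fin m) (Fin n) ℝ) : ℝ :=
  Real.sqrt (∑ j, ∑ i, (A j i) ^ 2)

/-- A quadratic form is bounded by the Frobenius norm of its matrix. -/
theorem quadratic_form_le_frobNorm {m : ℕ} (E : Matrix (Fin m) (Fin m) ℝ) (v : Fin m → ℝ) :
    ∑ a, ∑ b, E a b * (v a * v b) ≤ frobNorm E * ∑ a, v a ^ 2 := by
  have h := Finset.sum_mul_sq_le_sq_mul_sq (Finset.univ : Finset (Fin m × Fin m))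
    (fun p => E p.1 p.2) (fun p => v p.1 * v p.2)
  simp only [Fintype.sum_prod_type, mul_pow] at h
  have hv : ∑ a, ∑ b, v a ^ 2 * v b ^ 2 = (∑ a, v a ^ 2) ^ 2 := by
    rw [sq, Finset.sum_mul_sum]
  have hE : frobNorm E ^ 2 = ∑ a, ∑ b, E a b ^ 2 := Real.sq_sqrt (by positivity)
  rw [hv, ← hE, ← mul_pow] at h
  exact abs_le_of_sq_le_sq' h (mul_nonneg (Real.sqrt_nonneg _) (by positivity)) |>.2

/-- Each entry of a matrix is bounded in absolute value by the Frobenius norm. -/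
theorem abs_entry_le_frobNorm {m n : ℕ} (E : Matrix (Fin m) (Fin n) ℝ) (a : Fin m) (b : Fin n) :
    |E a b| ≤ frobNorm E := by
  refine Real.abs_le_sqrt ?_
  calc E a b ^ 2 ≤ ∑ i, E a i ^ 2 :=
        Finset.single_le_sum (f := fun i => E a i ^ 2) (fun _ _ => sq_nonneg _) (Finset.mem_univ b)
    _ ≤ ∑ j, ∑ i, E j i ^ 2 :=
        Finset.single_le_sum (f := fun j => ∑ i, E j i ^ 2) (fun _ _ => by positivity)
          (Finset.mem_univ a)

/-- The rows of a matrix with almost orthonormal columns have norm at most almost one. -/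
theorem row_sq_sum_le {n k : ℕ} (A : Matrix (Fin n) (Fin k) ℝ) (j : Fin n) :
    ∑ i, A j i ^ 2 ≤ 1 + frobNorm (Aᵀ * A - 1) := by
  set s := ∑ i, A j i ^ 2 with hs
  have hs0 : 0 ≤ s := by positivity
  have h := quadratic_form_le_frobNorm (Aᵀ * A - 1) (A j)
  have hexp : ∑ a, ∑ b, (Aᵀ * A - 1 : Matrix (Fin k) (Fin k) ℝ) a b * (A j a * A j b)
      = (A *ᵥ A j) ⬝ᵥ (A *ᵥ A j) - s := by
    have h1 : (A *ᵥ A j) ⬝ᵥ (A *ᵥ A j) = A j ⬝ᵥ ((Aᵀ * A) *ᵥ A j) := by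
      rw [← Matrix.mulVec_mulVec, Matrix.dotProduct_mulVec (A j), Matrix.vecMul_transpose]
    have h2 : s = A j ⬝ᵥ ((1 : Matrix (Fin k) (Fin k) ℝ) *ᵥ A j) := by
      rw [Matrix.one_mulVec, hs]
      simp [dotProduct, sq]
    rw [h1, h2, ← dotProduct_sub, ← Matrix.sub_mulVec]
    simp only [dotProduct, Matrix.mulVec, Finset.mul_sum]
    exact Finset.sum_congr rfl fun a _ => Finset.sum_congr rfl fun b _ => by ring
  have hj : s ^ 2 ≤ (A *ᵥ A j) ⬝ᵥ (A *ᵥ A j) := by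
    have h1 : s = (A *ᵥ A j) j := by
      rw [hs]
      simp [dotProduct, Matrix.mulVec, sq]
    rw [h1, sq]
    exact Finset.single_le_sum (f := fun l => (A *ᵥ A j) l * (A *ᵥ A j) l)
      (fun _ _ => mul_self_nonneg _) (Finset.mem_univ j)
  rw [hexp] at h
  by_contra! hlt
  have hF : 0 ≤ frobNorm (Aᵀ * A - 1) := Real.sqrt_nonneg _
  nlinarith

/-- The total mass of a matrix with almost orthonormal columns is at least almost `k`. -/
theorem le_sum_sq_of_almost_orthonormal {n k : ℕ} (A : Matrix (Fin n) (Fin k) ℝ) :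
    k * (1 - frobNorm (Aᵀ * A - 1)) ≤ ∑ j, ∑ i, A j i ^ 2 := by
  rw [Finset.sum_comm]
  have h : ∀ i ∈ (Finset.univ : Finset (Fin k)),
      1 - frobNorm (Aᵀ * A - 1) ≤ ∑ j, A j i ^ 2 := fun i _ => by
    have h1 := (abs_le.mp (abs_entry_le_frobNorm (Aᵀ * A - 1) i i)).1
    simp only [Matrix.sub_apply, Matrix.mul_apply, Matrix.transpose_apply, Matrix.one_apply_eq,
      ← sq] at h1
    linarith
  simpa using Finset.card_nsmul_le_sum _ _ _ h

/-- If the weights `s` are bounded by `M` and `lam` is monotone and bounded below by `-δ`, the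
weighted sum of `lam` is controlled by its value at `m`. -/
theorem le_weighted_sum_of_monotone {n : ℕ} (lam s : Fin n → ℝ) (hlam : Monotone lam)
    (m : Fin n) {M δ : ℝ} (hs0 : ∀ j, 0 ≤ s j) (hsM : ∀ j, s j ≤ M) (hδ : ∀ j, -δ ≤ lam j) :
    lam m * ∑ j, s j - m * ((lam m + δ) * M) ≤ ∑ j, lam j * s j := by
  have hpt : ∀ j ∈ (Finset.univ : Finset (Fin n)),
      lam m * s j - (if j < m then (lam m + δ) * M else 0) ≤ lam j * s j := fun j _ => by
    split_ifs with h
    · nlinarith [mul_nonneg (show 0 ≤ lam j + δ by linarith [hδ j]) (hs0 j),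
        mul_nonneg (show 0 ≤ lam m + δ by linarith [hδ m]) (sub_nonneg.2 (hsM j))]
    · nlinarith [mul_nonneg (sub_nonneg.2 (hlam (not_lt.1 h))) (hs0 j)]
  refine le_trans (le_of_eq ?_) (Finset.sum_le_sum hpt)
  rw [Finset.sum_sub_distrib, ← Finset.mul_sum, ← Finset.sum_filter, Finset.sum_const,
    nsmul_eq_mul, Finset.filter_gt_eq_Iio, Fin.card_Iio]

/-- Lemma 3.1: for `k ≤ n` positive, `c, ε > 0` and every `η > 0`,
there exist `c₁, ε' ∈ (0, η)` such that every `n × k` real matrix `A` with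
`‖AᵀA − I_k‖ ≤ c₁` and `‖A‖² ≤ c`, and all reals `λ₁ ≤ ⋯ ≤ λₙ` with `λ₁ ≥ −ε'` and
`λ_k ≥ ε/(2k)`, satisfy
`max(0, Σᵢ Σⱼ λⱼ a_{j,i}²) ≥ √ε' · (λ₁ + ⋯ + λ_k)`. -/
theorem almost_orthonormal_eigenvalue_lower_bound
    (k n : ℕ) (hk : 0 < k) (hkn : k ≤ n) (c ε : ℝ) (hc : 0 < c) (hε : 0 < ε)
    (η : ℝ) (hη : 0 < η) :
    ∃ c₁ ε' : ℝ, c₁ ∈ Set.Ioo 0 η ∧ ε' ∈ Set.Ioo 0 η ∧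
      ∀ A : Matrix (Fin n) (Fin k) ℝ,
        frobNorm (Aᵀ * A - 1) ≤ c₁ → frobNorm A ^ 2 ≤ c →
        ∀ lam : Fin n → ℝ, Monotone lam →
          -ε' ≤ lam ⟨0, by omega⟩ → ε / (2 * k) ≤ lam ⟨k - 1, by omega⟩ →
          Real.sqrt ε' * (∑ j : Fin k, lam (Fin.castLE hkn j)) ≤
            max 0 (∑ i : Fin k, ∑ j : Fin n, lam j * (A j i) ^ 2) := by
  have hk1 : (1 : ℝ) ≤ k := by exact_mod_cast hk
  have hk0 : (0 : ℝ) < k := by linarith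
  obtain ⟨c₁, hc0, hc1⟩ : ∃ x : ℝ, 0 < x ∧ x < min η (1 / (4 * k)) :=
    exists_between (lt_min hη (by positivity))
  obtain ⟨t, ht0, ht1⟩ : ∃ x : ℝ, 0 < x ∧ x < min (min η 1) (min (1 / (4 * k)) (ε / (16 * k ^ 2))) :=
    exists_between (by positivity)
  simp only [lt_min_iff] at hc1 ht1
  obtain ⟨hcη, hck⟩ := hc1
  obtain ⟨⟨htη, htone⟩, htk, htε⟩ := ht1
  rw [lt_div_iff₀ (by positivity)] at hck htk htε
  have htt : t ^ 2 ≤ t := by nlinarith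
  refine ⟨c₁, t ^ 2, ⟨hc0, hcη⟩, ⟨by positivity, by linarith⟩, ?_⟩
  intro A hA _ lam hlam h0 hlk
  rw [Real.sqrt_sq ht0.le]
  refine le_trans ?_ (le_max_right _ _)
  rw [Finset.sum_comm]
  simp_rw [← Finset.mul_sum]
  set L := lam ⟨k - 1, by omega⟩ with hL
  have hweighted := le_weighted_sum_of_monotone lam (fun j => ∑ i, A j i ^ 2) hlam
    ⟨k - 1, by omega⟩ (M := 1 + c₁) (δ := t ^ 2) (fun j => by positivity)
    (fun j => (row_sq_sum_le A j).trans (by linarith))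
    (fun j => h0.trans (hlam (Nat.zero_le _)))
  rw [← hL] at hweighted
  simp only [Nat.cast_sub (show 1 ≤ k from hk), Nat.cast_one] at hweighted
  have hmass : k * (1 - c₁) ≤ ∑ j, ∑ i, A j i ^ 2 :=
    le_trans (by gcongr) (le_sum_sq_of_almost_orthonormal A)
  have hL0 : 0 < L := lt_of_lt_of_le (by positivity) hlk
  have hsum : ∑ j : Fin k, lam (Fin.castLE hkn j) ≤ k * L := by
    have h : ∀ j ∈ (Finset.univ : Finset (Fin k)), lam (Fin.castLE hkn j) ≤ L := fun j _ =>
      hlam (Fin.mk_le_mk.2 (Nat.le_sub_one_of_lt j.2))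
    simpa using Finset.sum_le_card_nsmul _ _ _ h
  rw [div_le_iff₀ (by positivity)] at hlk
  have hLt : 8 * (k * t ^ 2) ≤ L := by
    have h : k * (8 * (k * t ^ 2)) ≤ k * L := by nlinarith
    exact le_of_mul_le_mul_left h hk0
  have hupper : t * ∑ j : Fin k, lam (Fin.castLE hkn j) ≤ L / 4 := by
    nlinarith [mul_le_mul_of_nonneg_left hsum ht0.le]
  have hmassL := mul_le_mul_of_nonneg_left hmass hL0.le
  have hmain : L / 2 ≤ L * (k * (1 - c₁)) - (k - 1) * (L * (1 + c₁)) := by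
    nlinarith [mul_pos hL0 hc0]
  have hc1 : c₁ ≤ 1 := by nlinarith
  have herr : (k - 1) * (t ^ 2 * (1 + c₁)) ≤ L / 4 := by
    have h1 : (k - 1) * (t ^ 2 * (1 + c₁)) ≤ k * (t ^ 2 * 2) := by
      gcongr <;> linarith
    linarith
  linarith
end

section
/- Let (X,d) be an (R,D)-thin metric space and let r : [0,∞) → X be a ray. If a point x ∈ X satisfies d(x, r(t)) = dist(x, r([0,∞))) for some t > R (i.e. the projection of x onto the ray meets r((R,∞))), then dist(x, r([0,∞))) ≤ D. -/
open Metric Set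

/-- `l` restricted to `[a, b]` is a unit-speed segment (isometric embedding of `[a,b]`). -/
def IsSegmentOn {X : Type*} [PseudoMetricSpace X] (l : ℝ → X) (a b : ℝ) : Prop :=
  ∀ s ∈ Set.Icc a b, ∀ t ∈ Set.Icc a b, dist (l s) (l t) = |s - t|

/-- A ray in `X`: an isometric embedding of `[0, ∞)`. -/
def IsRay {X : Type*} [PseudoMetricSpace X] (r : ℝ → X) : Prop :=
  ∀ s t : ℝ, 0 ≤ s → 0 ≤ t → dist (r s) (r t) = |s - t|

/-- `X` is a geodesic space: any two points are joined by a segment. -/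
def IsGeodesicSpace (X : Type*) [PseudoMetricSpace X] : Prop :=
  ∀ x y : X, ∃ f : ℝ → X, IsSegmentOn f 0 (dist x y) ∧ f 0 = x ∧ f (dist x y) = y

/-- The metric projection of a point `x` to a set `K`:
the set of points of `K` realizing the distance from `x` to `K`. -/
def metricProj {X : Type*} [PseudoMetricSpace X] (K : Set X) (x : X) : Set X :=
  {y ∈ K | dist x y = Metric.infDist x K}

/-- The metric projection of a set `A` to a set `K`. -/
def metricProjSet {X : Type*} [PseudoMetricSpace X] (K A : Set X) : Set X :=
  ⋃ x ∈ A, metricProj K x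

/-- `S` contains a `c`-net of `T`: every point of `T` is within distance `c` of `S`. -/
def ContainsNetOf {X : Type*} [PseudoMetricSpace X] (S T : Set X) (c : ℝ) : Prop :=
  ∀ p ∈ T, ∃ q ∈ S, dist p q ≤ c

/-- An `(R,D)`-thin metric space: a proper, separable, geodesic metric space
(with `R ≥ 20 D > 0`) such that for every segment `l` of length `L > 2R`, every
`t ∈ (R, L - R)` and every `x` whose projection to `l` meets `l(t)`, one has
`dist(x, l) < D`. -/
structure IsThinSpace (X : Type*) [MetricSpace X] (R D : ℝ) : Prop where
  R_pos : 0 < R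
  D_pos : 0 < D
  twentyD_le_R : 20 * D ≤ R
  proper : ProperSpace X
  separable : TopologicalSpace.SeparableSpace X
  geodesic : IsGeodesicSpace X
  thin : ∀ (l : ℝ → X) (L : ℝ), 2 * R < L → IsSegmentOn l 0 L →
    ∀ t ∈ Set.Ioo R (L - R), ∀ x : X,
      dist x (l t) = Metric.infDist x (l '' Set.Icc 0 L) →
      Metric.infDist x (l '' Set.Icc 0 L) < D

/-- Remark 4.4: in an `(R,D)`-thin metric space, if a point `x`
projects onto a ray `r` at a parameter `t > R`, then `dist(x, r) ≤ D`. -/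
theorem thin_proj_on_ray_far_implies_close
    {X : Type*} [MetricSpace X] {R D : ℝ} (hX : IsThinSpace X R D)
    {r : ℝ → X} (hr : IsRay r) {x : X} {t : ℝ} (ht : R < t)
    (hproj : dist x (r t) = Metric.infDist x (r '' Set.Ici 0)) :
    Metric.infDist x (r '' Set.Ici 0) ≤ D := by
  have hR := hX.R_pos
  have ht_nonneg : 0 ≤ t := (hR.trans ht).le
  have ht_mem : t ∈ Icc 0 (t + R + 1) := ⟨ht_nonneg, by linarith⟩
  have hseg : dist x (r t) = infDist x (r '' Icc 0 (t + R + 1)) := by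
    refine le_antisymm ?_ (infDist_le_dist_of_mem (mem_image_of_mem r ht_mem))
    rw [hproj]
    exact infDist_le_infDist_of_subset (image_mono Icc_subset_Ici_self)
      ⟨r t, mem_image_of_mem r ht_mem⟩
  have hlt := hX.thin r (t + R + 1) (by linarith)
    (fun a ha b hb => hr a b ha.1 hb.1) t ⟨ht, by linarith⟩ x hseg
  rw [← hproj, hseg]
  exact hlt.le
end

section
/- Let (X,d) be an (R,D)-thin metric space, let α : [0,L_α] → X be a 1-Lipschitz (e.g. unit-speed) curve, and let l : [0,L] → X be a segment with L > 2R. Let t ∈ (R, L−R) and u ∈ [0,R] ∪ [L−R, L]. If l(t) ∈ π_l(α(0)) and l(u) ∈ π_l(α(L_α)), then the set π_l(α([0,L_α])) contains a 3D-net of either l([R,t]) or l([t, L−R]). -/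
open Metric Set

theorem IsSegmentOn.continuousOn {X : Type*} [PseudoMetricSpace X] {l : ℝ → X} {a b : ℝ}
    (hl : IsSegmentOn l a b) : ContinuousOn l (Set.Icc a b) := by
  have h : LipschitzOnWith 1 l (Set.Icc a b) := by
    refine LipschitzOnWith.of_dist_le_mul fun x hx y hy => ?_
    rw [hl x hx y hy, Real.dist_eq]
    simp
  exact h.continuousOn

/-- Lemma 4.6, item 1: in an `(R,D)`-thin space, if a 1-Lipschitz curve
`α` starts projecting at `l(t)` with `t ∈ (R, L-R)` and ends projecting at `l(u)` with
`u ∈ [0,R] ∪ [L-R,L]`, then `π_l(α)` contains a `3D`-net of `l([R,t])` or of `l([t,L-R])`. -/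
theorem thin_proj_net_of_curve_endpoint_near_end
    {X : Type*} [MetricSpace X] {R D : ℝ} (hX : IsThinSpace X R D)
    {Lα : ℝ} (hLα : 0 ≤ Lα) {α : ℝ → X} (hα : LipschitzOnWith 1 α (Set.Icc 0 Lα))
    {l : ℝ → X} {L : ℝ} (hL : 2 * R < L) (hl : IsSegmentOn l 0 L)
    {t u : ℝ} (ht : t ∈ Set.Ioo R (L - R))
    (hu : u ∈ Set.Icc 0 R ∪ Set.Icc (L - R) L)
    (hproj0 : l t ∈ metricProj (l '' Set.Icc 0 L) (α 0))
    (hproj1 : l u ∈ metricProj (l '' Set.Icc 0 L) (α Lα)) :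
    ContainsNetOf (metricProjSet (l '' Set.Icc 0 L) (α '' Set.Icc 0 Lα))
        (l '' Set.Icc R t) (3 * D) ∨
      ContainsNetOf (metricProjSet (l '' Set.Icc 0 L) (α '' Set.Icc 0 Lα))
        (l '' Set.Icc t (L - R)) (3 * D) := by
  have hD := hX.D_pos
  have hR := hX.R_pos
  set K := l '' Set.Icc 0 L with hK
  by_contra hcon
  simp only [ContainsNetOf] at hcon
  push Not at hcon
  obtain ⟨⟨_, ⟨p, ⟨hRp, hpt⟩, rfl⟩, hp⟩, ⟨_, ⟨q, ⟨htq, hqL⟩, rfl⟩, hq⟩⟩ := hcon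
  have hp0 : p ∈ Set.Icc 0 L := ⟨by linarith, by linarith⟩
  have hq0 : q ∈ Set.Icc 0 L := ⟨by linarith, by linarith⟩
  -- The parameters that avoid both gaps split into an inner and an outer compact set.
  set M := Set.Icc (p + 3 * D) (q - 3 * D) with hM
  set N := (Set.Icc 0 (p - 3 * D) ∪ Set.Icc (q + 3 * D) L) with hN
  have hM0 : M ⊆ Set.Icc 0 L := Set.Icc_subset_Icc (by linarith) (by linarith)
  have hN0 : N ⊆ Set.Icc 0 L := Set.union_subset
    (Set.Icc_subset_Icc le_rfl (by linarith)) (Set.Icc_subset_Icc (by linarith) le_rfl)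
  have hgap : ∀ s ∈ Set.Icc 0 Lα, ∀ v ∈ Set.Icc 0 L, dist (α s) (l v) = infDist (α s) K →
      3 * D < |p - v| ∧ 3 * D < |q - v| := by
    intro s hs v hv hd
    have hmem : l v ∈ metricProjSet K (α '' Set.Icc 0 Lα) :=
      Set.mem_biUnion (Set.mem_image_of_mem α hs) ⟨Set.mem_image_of_mem l hv, hd⟩
    rw [← hl p hp0 v hv, ← hl q hq0 v hv]
    exact ⟨hp _ hmem, hq _ hmem⟩
  have ht0 : t ∈ Set.Icc 0 L := ⟨by linarith [ht.1], by linarith [ht.2]⟩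
  have hu0 : u ∈ Set.Icc 0 L := by
    rcases hu with h | h
    · exact ⟨h.1, by linarith [h.2]⟩
    · exact ⟨by linarith [h.1], h.2⟩
  have htM : t ∈ M := by
    obtain ⟨h1, h2⟩ := hgap 0 ⟨le_rfl, hLα⟩ t ht0 hproj0.2
    rw [abs_of_nonpos (by linarith)] at h1
    rw [abs_of_nonneg (by linarith)] at h2
    exact ⟨by linarith, by linarith⟩
  have huN : u ∈ N := by
    obtain ⟨h1, h2⟩ := hgap Lα ⟨hLα, le_rfl⟩ u hu0 hproj1.2
    rcases hu with h | h
    · rw [abs_of_nonneg (by linarith [h.2])] at h1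
      exact Or.inl ⟨h.1, by linarith⟩
    · rw [abs_of_nonpos (by linarith [h.1])] at h2
      exact Or.inr ⟨by linarith, h.2⟩
  have hlM : l t ∈ l '' M := Set.mem_image_of_mem l htM
  have hlN : l u ∈ l '' N := Set.mem_image_of_mem l huN
  have hKM : ∀ x, infDist x K ≤ infDist x (l '' M) := fun x =>
    infDist_le_infDist_of_subset (Set.image_mono hM0) ⟨_, hlM⟩
  have hKN : ∀ x, infDist x K ≤ infDist x (l '' N) := fun x =>
    infDist_le_infDist_of_subset (Set.image_mono hN0) ⟨_, hlN⟩
  obtain ⟨s, hs, hMN⟩ : ∃ s ∈ Set.Icc 0 Lα,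
      infDist (α s) (l '' M) = infDist (α s) (l '' N) :=
    isPreconnected_Icc.intermediate_value₂ ⟨le_rfl, hLα⟩ ⟨hLα, le_rfl⟩
      ((continuous_infDist_pt _).comp_continuousOn hα.continuousOn)
      ((continuous_infDist_pt _).comp_continuousOn hα.continuousOn)
      ((infDist_le_dist_of_mem hlM).trans (hproj0.2.trans_le (hKN _)))
      ((infDist_le_dist_of_mem hlN).trans (hproj1.2.trans_le (hKM _)))
  have hcK : IsCompact K := isCompact_Icc.image_of_continuousOn hl.continuousOn
  have hcM : IsCompact (l '' M) :=
    isCompact_Icc.image_of_continuousOn (hl.continuousOn.mono hM0)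
  have hcN : IsCompact (l '' N) :=
    (isCompact_Icc.union isCompact_Icc).image_of_continuousOn (hl.continuousOn.mono hN0)
  have hKeq : infDist (α s) (l '' M) ≤ infDist (α s) K := by
    obtain ⟨_, ⟨v, hv, rfl⟩, hvd⟩ :=
      hcK.exists_infDist_eq_dist ⟨_, Set.mem_image_of_mem l ht0⟩ (α s)
    obtain ⟨h1, h2⟩ := hgap s hs v hv hvd.symm
    have hvMN : v ∈ M ∨ v ∈ N := by
      rcases lt_abs.1 h1 with h1 | h1
      · exact Or.inr (Or.inl ⟨hv.1, by linarith⟩)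
      · rcases lt_abs.1 h2 with h2 | h2
        · exact Or.inl ⟨by linarith, by linarith⟩
        · exact Or.inr (Or.inr ⟨by linarith, hv.2⟩)
    rw [hvd]
    rcases hvMN with h | h
    · exact infDist_le_dist_of_mem (Set.mem_image_of_mem l h)
    · rw [hMN]
      exact infDist_le_dist_of_mem (Set.mem_image_of_mem l h)
  obtain ⟨_, ⟨a, ha, rfl⟩, had⟩ := hcM.exists_infDist_eq_dist ⟨_, hlM⟩ (α s)
  obtain ⟨_, ⟨b, hb, rfl⟩, hbd⟩ := hcN.exists_infDist_eq_dist ⟨_, hlN⟩ (α s)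
  have haK : dist (α s) (l a) = infDist (α s) K := had ▸ hKeq.antisymm (hKM _)
  have hthin := hX.thin l L hL hl a ⟨by linarith [ha.1], by linarith [ha.2]⟩ (α s) haK
  have hab : |a - b| < 2 * D := by
    rw [← hl a (hM0 ha) b (hN0 hb)]
    linarith [dist_triangle_left (l a) (l b) (α s)]
  rw [abs_lt] at hab
  rcases hb with h | h
  · linarith [ha.1, h.2]
  · linarith [ha.2, h.1]
end

section
/- Let (X,d) be an (R,D)-thin metric space, let α : [0,L_α] → X be a 1-Lipschitz (e.g. unit-speed) curve, and let r : [0,∞) → X be a ray. Let t > R and u ∈ [0,R]. If r(t) ∈ π_r(α(0)) and r(u) ∈ π_r(α(L_α)), then the set π_r(α([0,L_α])) contains a 3D-net of r([R,t]). -/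
open Metric Set

/-- The image of a ray is closed. -/
theorem IsRay.isClosed_image {X : Type*} [MetricSpace X] {r : ℝ → X} (hr : IsRay r) :
    IsClosed (r '' Set.Ici 0) := by
  rw [Set.image_eq_range]
  have := (isClosed_Ici (a := (0 : ℝ))).isComplete.completeSpace_coe
  have hiso : Isometry fun x : Set.Ici (0 : ℝ) => r x :=
    Isometry.of_dist_eq fun x y => hr x y x.2 y.2
  exact hiso.isClosedEmbedding.isClosed_range

/-- In a thin space, a point projecting to a ray at a parameter larger than `R` is
`D`-close to its projection. -/
theorem IsThinSpace.dist_lt_of_mem_metricProj_ray {X : Type*} [MetricSpace X] {R D : ℝ}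
    (hX : IsThinSpace X R D) {r : ℝ → X} (hr : IsRay r) {x : X} {a : ℝ} (ha : R < a)
    (hx : r a ∈ metricProj (r '' Set.Ici 0) x) : dist x (r a) < D := by
  have hR := hX.R_pos
  have hmem : r a ∈ r '' Set.Icc 0 (a + R + 1) := ⟨a, ⟨by linarith, by linarith⟩, rfl⟩
  have hsub : r '' Set.Icc 0 (a + R + 1) ⊆ r '' Set.Ici 0 := Set.image_mono fun _ h => h.1
  have heq : dist x (r a) = infDist x (r '' Set.Icc 0 (a + R + 1)) :=
    le_antisymm (hx.2.trans_le (infDist_le_infDist_of_subset hsub ⟨_, hmem⟩))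
      (infDist_le_dist_of_mem hmem)
  rw [heq]
  exact hX.thin r (a + R + 1) (by linarith) (fun s hs t ht => hr s t hs.1 ht.1) a
    ⟨ha, by linarith⟩ x heq

/-- In a thin space, projecting to a ray moves `D`-close points to `4D`-close points, provided
one of the projections has parameter larger than `R`. -/
theorem IsThinSpace.abs_sub_lt_of_mem_metricProj_ray {X : Type*} [MetricSpace X] {R D : ℝ}
    (hX : IsThinSpace X R D) {r : ℝ → X} (hr : IsRay r) {x y : X} (hxy : dist x y ≤ D)
    {a b : ℝ} (ha : R < a) (hb : 0 ≤ b) (hx : r a ∈ metricProj (r '' Set.Ici 0) x)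
    (hy : r b ∈ metricProj (r '' Set.Ici 0) y) : |a - b| < 4 * D := by
  have hR := hX.R_pos
  have hxa := hX.dist_lt_of_mem_metricProj_ray hr ha hx
  have hyb : dist y (r b) ≤ dist y (r a) := hy.2.trans_le (infDist_le_dist_of_mem hx.1)
  have hya : dist y (r a) ≤ dist x y + dist x (r a) := dist_triangle_left y (r a) x
  have hab : dist (r a) (r b) ≤ dist y (r a) + dist y (r b) := dist_triangle_left _ _ _
  rw [← hr a b (by linarith) hb]
  linarith

/-- Lemma 4.6, item 3: in an `(R,D)`-thin space, if a 1-Lipschitz curve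
`α` starts projecting on a ray `r` at `r(t)` with `t > R` and ends projecting at `r(u)`
with `u ∈ [0,R]`, then `π_r(α)` contains a `3D`-net of `r([R,t])`. -/
theorem thin_proj_net_of_curve_on_ray
    {X : Type*} [MetricSpace X] {R D : ℝ} (hX : IsThinSpace X R D)
    {Lα : ℝ} (hLα : 0 ≤ Lα) {α : ℝ → X} (hα : LipschitzOnWith 1 α (Set.Icc 0 Lα))
    {r : ℝ → X} (hr : IsRay r)
    {t u : ℝ} (ht : R < t) (hu : u ∈ Set.Icc 0 R)
    (hproj0 : r t ∈ metricProj (r '' Set.Ici 0) (α 0))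
    (hproj1 : r u ∈ metricProj (r '' Set.Ici 0) (α Lα)) :
    ContainsNetOf (metricProjSet (r '' Set.Ici 0) (α '' Set.Icc 0 Lα))
      (r '' Set.Icc R t) (3 * D) := by
  rintro _ ⟨v, ⟨hRv, hvt⟩, rfl⟩
  by_contra! hfar
  have hD := hX.D_pos
  have hR := hX.R_pos
  have := hX.proper
  have hgap : ∀ s ∈ Set.Icc 0 Lα, ∀ w, 0 ≤ w →
      r w ∈ metricProj (r '' Set.Ici 0) (α s) → 3 * D < |v - w| := by
    intro s hs w hw hproj
    rw [← hr v w (by linarith) hw]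
    exact hfar _ (Set.mem_biUnion (Set.mem_image_of_mem α hs) hproj)
  have hstep : ∀ s ∈ Set.Icc 0 Lα, ∀ s' ∈ Set.Icc 0 Lα, |s - s'| ≤ D → ∀ a, v < a →
      r a ∈ metricProj (r '' Set.Ici 0) (α s) → ∀ b, 0 ≤ b →
      r b ∈ metricProj (r '' Set.Ici 0) (α s') → v + 3 * D < b := by
    intro s hs s' hs' hss' a hva hpa b hb hpb
    have hdist : dist (α s) (α s') ≤ D := by
      have h := hα.dist_le_mul s hs s' hs'
      rw [NNReal.coe_one, one_mul, Real.dist_eq] at h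
      exact h.trans hss'
    have hab := abs_lt.1 (hX.abs_sub_lt_of_mem_metricProj_ray hr hdist (by linarith) hb hpa hpb)
    have hga := hgap s hs a (by linarith) hpa
    have hgb := hgap s' hs' b hb hpb
    rcases lt_abs.1 hga with h | h <;> rcases lt_abs.1 hgb with h' | h' <;> linarith
  have hind : ∀ n : ℕ, ∀ s ∈ Set.Icc 0 Lα, s ≤ n * D →
      ∃ a, v < a ∧ r a ∈ metricProj (r '' Set.Ici 0) (α s) := by
    intro n
    induction n with
    | zero =>
      intro s hs hsn
      obtain rfl : s = 0 := le_antisymm (by simpa using hsn) hs.1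
      refine ⟨t, lt_of_le_of_ne hvt fun h => ?_, hproj0⟩
      have hgt := hgap 0 hs t (by linarith) hproj0
      rw [h, sub_self, abs_zero] at hgt
      linarith
    | succ n ih =>
      intro s hs hsn
      push_cast at hsn
      have hs₀ : max 0 (s - D) ∈ Set.Icc 0 Lα :=
        ⟨le_max_left _ _, max_le hLα (by linarith [hs.2])⟩
      obtain ⟨a, hva, hpa⟩ := ih _ hs₀ (max_le (by positivity) (by linarith))
      have hclose : |max 0 (s - D) - s| ≤ D := by
        rw [abs_le]
        exact ⟨by linarith [le_max_right 0 (s - D)],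
          by linarith [max_le hs.1 (show s - D ≤ s by linarith)]⟩
      obtain ⟨_, ⟨b, hb, rfl⟩, hpb⟩ := hr.isClosed_image.exists_infDist_eq_dist
        ⟨_, Set.mem_image_of_mem r Set.self_mem_Ici⟩ (α s)
      have hproj : r b ∈ metricProj (r '' Set.Ici 0) (α s) :=
        ⟨Set.mem_image_of_mem r hb, hpb.symm⟩
      exact ⟨b, by linarith [hstep _ hs₀ s hs hclose a hva hpa b hb hproj], hproj⟩
  have hend : Lα ∈ Set.Icc 0 Lα := ⟨hLα, le_rfl⟩
  obtain ⟨n, hn⟩ := exists_nat_ge (Lα / D)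
  obtain ⟨a, hva, hpa⟩ := hind n Lα hend ((div_le_iff₀ hD).1 hn)
  have hvu := hstep Lα hend Lα hend (by simpa using hD.le) a hva hpa u hu.1 hproj1
  linarith [hu.2]
end

section
/- Let (X,d) be an (R,D)-thin metric space, let r : [0,∞) → X be a ray, and let y ∈ X be a point with dist(y, r([0,∞))) > D. Let t > 0 and let γ : [0,L_γ] → X be a 1-Lipschitz curve with γ(0) = r(t) and γ(L_γ) = y. Then for every s ∈ [0,t] one has dist(r(s), γ([0,L_γ])) ≤ 2R. -/
open Metric Set

theorem IsRay.isSegmentOn {X : Type*} [PseudoMetricSpace X] {r : ℝ → X} (hr : IsRay r) {a b : ℝ}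
    (ha : 0 ≤ a) : IsSegmentOn r a b :=
  fun s hs t ht => hr s t (ha.trans hs.1) (ha.trans ht.1)

/-- If the final part `[m, L]` of a long initial piece of a ray, with `m > R`, is at least as close
to `x` as the initial part `[0, m]`, then it is within distance `D` of `x`. -/
theorem IsThinSpace.infDist_final_lt {X : Type*} [MetricSpace X] {R D : ℝ}
    (hX : IsThinSpace X R D) {r : ℝ → X} (hr : IsRay r) {m L : ℝ} (hm : R < m) (hmL : m ≤ L)
    {x : X} (hL : 2 * dist x (r 0) + 2 * R < L)
    (hx : infDist x (r '' Icc m L) ≤ infDist x (r '' Icc 0 m)) :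
    infDist x (r '' Icc m L) < D := by
  have hR := hX.R_pos
  have hm0 : 0 ≤ m := by linarith
  obtain ⟨_, ⟨u, hu, rfl⟩, hxu⟩ :=
    (isCompact_Icc.image_of_continuousOn
      (hr.isSegmentOn hm0 : IsSegmentOn r m L).continuousOn).exists_infDist_eq_dist
      ((nonempty_Icc.2 hmL).image r) x
  have hu0 : 0 ≤ u := hm0.trans hu.1
  have hnear : ∀ v ∈ Icc 0 L, dist x (r u) ≤ dist x (r v) := by
    intro v hv
    rw [← hxu]
    rcases le_total v m with h | h
    · exact hx.trans (infDist_le_dist_of_mem (mem_image_of_mem r ⟨hv.1, h⟩))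
    · exact infDist_le_dist_of_mem (mem_image_of_mem r ⟨h, hv.2⟩)
  have huL : u ∈ Icc 0 L := ⟨hu0, hu.2⟩
  have heq : dist x (r u) = infDist x (r '' Icc 0 L) := by
    refine le_antisymm ?_ (infDist_le_dist_of_mem (mem_image_of_mem r huL))
    refine (le_infDist ⟨_, mem_image_of_mem r huL⟩).2 ?_
    rintro _ ⟨v, hv, rfl⟩
    exact hnear v hv
  have hu_le : u ≤ 2 * dist x (r 0) := by
    have h0 := hnear 0 ⟨le_rfl, hm0.trans hmL⟩
    have h1 := dist_triangle_left (r u) (r 0) x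
    rw [hr u 0 hu0 le_rfl, sub_zero, abs_of_nonneg hu0] at h1
    linarith
  rw [hxu, heq]
  exact hX.thin r L (by linarith [dist_nonneg (x := x) (y := r 0)]) (hr.isSegmentOn le_rfl) u
    ⟨hm.trans_le hu.1, by linarith⟩ x heq

/-- Lemma 4.7: in an `(R,D)`-thin space, if `y` is at distance `> D`
from a ray `r` and `γ` is a curve connecting `r(t)` to `y`, then every point `r(s)` with
`s ∈ [0,t]` is within distance `2R` of the curve `γ`. -/
theorem thin_curve_to_far_point_passes_near_ray
    {X : Type*} [MetricSpace X] {R D : ℝ} (hX : IsThinSpace X R D)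
    {r : ℝ → X} (hr : IsRay r) {y : X} (hy : D < Metric.infDist y (r '' Set.Ici 0))
    {t : ℝ} (ht : 0 < t) {Lγ : ℝ} (hLγ : 0 ≤ Lγ) {γ : ℝ → X}
    (hγ : LipschitzOnWith 1 γ (Set.Icc 0 Lγ)) (hγ0 : γ 0 = r t) (hγ1 : γ Lγ = y) :
    ∀ s ∈ Set.Icc 0 t, Metric.infDist (r s) (γ '' Set.Icc 0 Lγ) ≤ 2 * R := by
  intro s hs
  have hR := hX.R_pos
  have hD := hX.D_pos
  have hRD := hX.twentyD_le_R
  have h0_mem : (0 : ℝ) ∈ Icc 0 Lγ := left_mem_Icc.2 hLγ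
  have hL_mem : Lγ ∈ Icc 0 Lγ := right_mem_Icc.2 hLγ
  rcases lt_or_ge t (R + D) with htR | htR
  · refine (infDist_le_dist_of_mem (mem_image_of_mem γ h0_mem)).trans ?_
    rw [hγ0, hr s t hs.1 ht.le, abs_sub_comm, abs_of_nonneg (by linarith [hs.2])]
    linarith [hs.1]
  set m := max s (R + D) with hm
  have hsm : s ≤ m := le_max_left _ _
  have hRm : R + D ≤ m := le_max_right _ _
  have hmt : m ≤ t := max_le hs.2 htR
  have hms : m ≤ s + (R + D) := max_le (by linarith) (by linarith [hs.1])
  have hm0 : 0 ≤ m := by linarith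
  set L := 2 * (Lγ + t) + 2 * R + 1 with hL
  have hmL : m ≤ L := by linarith
  have hne : (r '' Icc m L).Nonempty := (nonempty_Icc.2 hmL).image r
  have hne' : (r '' Icc 0 m).Nonempty := (nonempty_Icc.2 hm0).image r
  have hclose : ∀ τ ∈ Icc 0 Lγ, infDist (γ τ) (r '' Icc m L) ≤ infDist (γ τ) (r '' Icc 0 m) →
      infDist (γ τ) (r '' Icc m L) < D := by
    intro τ hτ
    refine hX.infDist_final_lt hr (by linarith) hmL ?_
    have h1 := hγ.dist_le_mul τ hτ 0 h0_mem
    rw [hγ0, Real.dist_eq, sub_zero, abs_of_nonneg hτ.1, NNReal.coe_one, one_mul] at h1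
    have h2 := dist_triangle (γ τ) (r t) (r 0)
    rw [hr t 0 ht.le le_rfl, sub_zero, abs_of_pos ht] at h2
    linarith [hτ.2]
  have hy_near : infDist (γ Lγ) (r '' Icc 0 m) ≤ infDist (γ Lγ) (r '' Icc m L) := by
    by_contra! h
    have h1 := hclose Lγ hL_mem h.le
    have h2 : infDist y (r '' Ici 0) ≤ infDist y (r '' Icc m L) :=
      infDist_le_infDist_of_subset (image_mono fun v hv => hm0.trans hv.1) hne
    rw [hγ1] at h1
    linarith
  have h0_near : infDist (γ 0) (r '' Icc m L) ≤ infDist (γ 0) (r '' Icc 0 m) := by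
    rw [hγ0, infDist_zero_of_mem (mem_image_of_mem r (mem_Icc.2 ⟨hmt, by linarith⟩))]
    exact infDist_nonneg
  obtain ⟨τ, hτ, hτeq⟩ : ∃ τ ∈ Icc 0 Lγ,
      infDist (γ τ) (r '' Icc m L) = infDist (γ τ) (r '' Icc 0 m) :=
    isPreconnected_Icc.intermediate_value₂ h0_mem hL_mem
      ((continuous_infDist_pt _).comp_continuousOn hγ.continuousOn)
      ((continuous_infDist_pt _).comp_continuousOn hγ.continuousOn) h0_near hy_near
  have hlt := hclose τ hτ hτeq.le
  obtain ⟨_, ⟨u, hu, rfl⟩, hxu⟩ := (infDist_lt_iff hne).1 hlt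
  obtain ⟨_, ⟨v, hv, rfl⟩, hxv⟩ := (infDist_lt_iff hne').1 (hτeq ▸ hlt)
  have huv := dist_triangle_left (r u) (r v) (γ τ)
  rw [hr u v (hm0.trans hu.1) hv.1] at huv
  have hvm : dist (r s) (r u) ≤ R + D + 2 * D := by
    rw [hr s u hs.1 (hm0.trans hu.1), abs_sub_comm, abs_of_nonneg (by linarith [hu.1])]
    linarith [le_abs_self (u - v), hv.2]
  refine (infDist_le_dist_of_mem (mem_image_of_mem γ hτ)).trans ?_
  linarith [dist_triangle_right (r s) (γ τ) (r u)]
end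

section
/- Let (X,d) be an (R,D)-thin metric space. Let l : [0,Λ] → X be a segment with Λ ≥ 10R, let p ∈ X be a point with dist(p, l([0,Λ])) ≥ 10R, and let l̄ : [0,M] → X be a segment with l̄(0) = p and l̄(M) = l(0). If π_l(l̄([0,M])) ∩ l([3R, Λ−3R]) ≠ ∅, then M > Λ, i.e. the length of l̄ is strictly greater than the length of l. -/
open Metric Set

/-- Lemma 4.13: in an `(R,D)`-thin space, let `l` be a segment of
length `Λ ≥ 10R`, `p` a point with `dist(p, l) ≥ 10R`, and `l̄` a segment from `p` to
`l(0)`. If `π_l(l̄)` meets `l([3R, Λ-3R])`, then `l̄` is strictly longer than `l`. -/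
theorem thin_segment_to_far_point_longer
    {X : Type*} [MetricSpace X] {R D : ℝ} (hX : IsThinSpace X R D)
    {l : ℝ → X} {Λ : ℝ} (hΛ : 10 * R ≤ Λ) (hl : IsSegmentOn l 0 Λ)
    {p : X} (hp : 10 * R ≤ Metric.infDist p (l '' Set.Icc 0 Λ))
    {lb : ℝ → X} {M : ℝ} (hM : 0 ≤ M) (hlb : IsSegmentOn lb 0 M)
    (h0 : lb 0 = p) (h1 : lb M = l 0)
    (hint : (metricProjSet (l '' Set.Icc 0 Λ) (lb '' Set.Icc 0 M) ∩
      l '' Set.Icc (3 * R) (Λ - 3 * R)).Nonempty) :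
    Λ < M := by
  have hR := hX.R_pos
  have hD := hX.D_pos
  have hDR := hX.twentyD_le_R
  have hΛ0 : 0 ≤ Λ := by linarith
  set K := l '' Set.Icc 0 Λ
  have hKc : IsCompact K := isCompact_Icc.image_of_continuousOn hl.continuousOn
  have hKn : K.Nonempty := (Set.nonempty_Icc.2 hΛ0).image l
  have h0K : (0 : ℝ) ∈ Set.Icc 0 Λ := ⟨le_rfl, hΛ0⟩
  obtain ⟨y, hy, t₀, ht₀, rfl⟩ := hint
  simp only [metricProjSet, Set.mem_iUnion] at hy
  obtain ⟨x, ⟨u₀, hu₀, rfl⟩, -, hproj⟩ := hy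
  have ht₀K : t₀ ∈ Set.Icc 0 Λ := ⟨by linarith [ht₀.1], by linarith [ht₀.2]⟩
  have hclose : infDist (lb u₀) K < D :=
    hX.thin l Λ (by linarith) hl t₀ ⟨by linarith [ht₀.1], by linarith [ht₀.2]⟩ _ hproj
  have hMend : M ∈ Set.Icc 0 M := ⟨hM, le_rfl⟩
  -- the distance to `l(0)` along `l̄` and along `l`
  have hdist_lb : ∀ u ∈ Set.Icc 0 M, dist (lb u) (l 0) = M - u := fun u hu => by
    rw [← h1, hlb u hu M hMend, abs_sub_comm, abs_of_nonneg (by linarith [hu.2])]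
  have hdist_l : ∀ t ∈ Set.Icc 0 Λ, dist (l t) (l 0) = t := fun t ht => by
    rw [hl t ht 0 h0K, sub_zero, abs_of_nonneg ht.1]
  have hcont : ContinuousOn (fun u => infDist (lb u) K) (Set.Icc 0 u₀) :=
    (continuous_infDist_pt K).comp_continuousOn
      (hlb.continuousOn.mono (Set.Icc_subset_Icc_right hu₀.2))
  obtain ⟨u₁, hu₁, hu₁D⟩ : D ∈ (fun u => infDist (lb u) K) '' Set.Icc 0 u₀ :=
    intermediate_value_Icc' hu₀.1 hcont ⟨hclose.le, by simp only [h0]; linarith⟩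
  simp only at hu₁D
  have hu₁M : u₁ ∈ Set.Icc 0 M := ⟨hu₁.1, hu₁.2.trans hu₀.2⟩
  obtain ⟨z, ⟨t₁, ht₁, rfl⟩, hz⟩ := hKc.exists_infDist_eq_dist hKn (lb u₁)
  have hend : ¬ t₁ ∈ Set.Ioo R (Λ - R) := fun h =>
    (hX.thin l Λ (by linarith) hl t₁ h _ hz.symm).ne hu₁D
  have e₀ := dist_triangle_left (l t₀) (l 0) (lb u₀)
  have e₁ := dist_triangle (lb u₁) (l t₁) (l 0)
  have e₂ : infDist p K ≤ infDist (lb u₁) K + dist p (lb u₁) := infDist_le_infDist_add_dist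
  rw [hdist_l _ ht₀K, hdist_lb _ hu₀, hproj] at e₀
  rw [hdist_lb _ hu₁M, hdist_l _ ht₁, ← hz, hu₁D] at e₁
  rw [← h0, hlb 0 ⟨le_rfl, hM⟩ u₁ hu₁M, zero_sub, abs_neg, abs_of_nonneg hu₁.1, h0, hu₁D] at e₂
  have hfar : Λ - R ≤ t₁ := by
    by_contra! h
    exact hend ⟨by linarith [ht₀.1, hu₁.2], h⟩
  have e₃ := dist_triangle_left (l t₁) (l 0) (lb u₁)
  rw [hdist_l _ ht₁, hdist_lb _ hu₁M, ← hz, hu₁D] at e₃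
  linarith
end
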